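/- arXiv:0806.1587 — 3 statements merged into one kernel-verified Lean document; each statement's English description precedes it below -/
import Mathlib

section
/- If an opinion distribution p is not a fixed point of the DW interactive Markov chain (i.e. (pB^DW(p,ε)) k ≠ p k for some k ∈ {1,…,n}), then L(pB^DW(p,ε)) < L(p); that is, L is a strict Lyapunov function for the DW chain. -/
open Finset
open scoped Classical

/-- `p : ℤ → ℝ` is an opinion distribution on the classes `{1,…,n}`:
nonnegative, vanishing outside `{1,…,n}`, summing to `1`. -/
def IsDist (n : ℤ) (p : ℤ → ℝ) : Prop :=
  (∀ m, 0 ≤ p m) ∧ (∀ m, m ∉ Finset.Icc (1:ℤ) n → p m = 0) ∧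
    (∑ k ∈ Finset.Icc (1:ℤ) n, p k) = 1

/-- `π^i m = p m` if `|i - m| ≤ ε`, else `0`. -/
noncomputable def piF (p : ℤ → ℝ) (ε i m : ℤ) : ℝ :=
  if |i - m| ≤ ε then p m else 0

/-- Off-diagonal entry of the Deffuant–Weisbuch transition matrix. -/
noncomputable def BDWoff (p : ℤ → ℝ) (ε i j : ℤ) : ℝ :=
  piF p ε i (2*j - i - 1) / 2 + piF p ε i (2*j - i) + piF p ε i (2*j - i + 1) / 2

/-- The Deffuant–Weisbuch transition matrix `B^DW(p,ε)` on `{1,…,n} × {1,…,n}`. -/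
noncomputable def BDW (n : ℤ) (p : ℤ → ℝ) (ε i j : ℤ) : ℝ :=
  if i = j then 1 - ∑ j' ∈ (Finset.Icc (1:ℤ) n).erase i, BDWoff p ε i j'
  else BDWoff p ε i j

/-- One step of the DW interactive Markov chain: `(pB^DW(p,ε)) k`. -/
noncomputable def stepDW (n : ℤ) (p : ℤ → ℝ) (ε : ℤ) (k : ℤ) : ℝ :=
  ∑ i ∈ Finset.Icc (1:ℤ) n, p i * BDW n p ε i k

/-- The Lyapunov function `L(p) = ∑_{i=1}^n 2^i p i`. -/
noncomputable def Lyap (n : ℤ) (p : ℤ → ℝ) : ℝ :=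
  ∑ i ∈ Finset.Icc (1:ℤ) n, (2:ℝ)^i * p i

lemma piF_eq_zero (n : ℤ) (p : ℤ → ℝ) (ε i : ℤ) (hp : IsDist n p) (m : ℤ)
    (hm : m ∉ Finset.Icc (1:ℤ) n) : piF p ε i m = 0 := by
  unfold piF
  rw [hp.2.1 m hm]; simp

lemma sum_piF_ind (n : ℤ) (p : ℤ → ℝ) (ε i : ℤ) (hp : IsDist n p) (c : ℤ) :
    ∑ m ∈ Finset.Icc (1:ℤ) n, piF p ε i m * (if m = c then (1:ℝ) else 0) = piF p ε i c := by
  simp only [mul_ite, mul_one, mul_zero, Finset.sum_ite_eq']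
  split_ifs with h
  · rfl
  · exact (piF_eq_zero n p ε i hp c h).symm

lemma BDWoff_eq (n : ℤ) (p : ℤ → ℝ) (ε i k : ℤ) (hp : IsDist n p) :
    BDWoff p ε i k = ∑ m ∈ Finset.Icc (1:ℤ) n, piF p ε i m *
      (((if k = (i+m)/2 then (1:ℝ) else 0) + (if k = (i+m+1)/2 then (1:ℝ) else 0)) / 2) := by
  unfold BDWoff
  rw [← sum_piF_ind n p ε i hp (2*k-i-1), ← sum_piF_ind n p ε i hp (2*k-i),
    ← sum_piF_ind n p ε i hp (2*k-i+1), Finset.sum_div, Finset.sum_div,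
    ← Finset.sum_add_distrib, ← Finset.sum_add_distrib]
  refine Finset.sum_congr rfl fun m _ => ?_
  have e1 : (if k = (i+m)/2 then (1:ℝ) else 0) =
      (if m = 2*k-i then (1:ℝ) else 0) + (if m = 2*k-i+1 then (1:ℝ) else 0) := by
    split_ifs <;> first | omega | norm_num
  have e2 : (if k = (i+m+1)/2 then (1:ℝ) else 0) =
      (if m = 2*k-i-1 then (1:ℝ) else 0) + (if m = 2*k-i then (1:ℝ) else 0) := by
    split_ifs <;> first | omega | norm_num
  rw [e1, e2]; ring

lemma sum_BDWoff (n : ℤ) (p : ℤ → ℝ) (ε i : ℤ) (hp : IsDist n p) (hi : i ∈ Finset.Icc (1:ℤ) n)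
    (g : ℤ → ℝ) :
    ∑ k ∈ Finset.Icc (1:ℤ) n, g k * BDWoff p ε i k =
      ∑ m ∈ Finset.Icc (1:ℤ) n, piF p ε i m * ((g ((i+m)/2) + g ((i+m+1)/2)) / 2) := by
  simp_rw [BDWoff_eq n p ε i _ hp, Finset.mul_sum]
  rw [Finset.sum_comm]
  refine Finset.sum_congr rfl fun m hm => ?_
  rw [Finset.mem_Icc] at hi hm
  have h1 : (i+m)/2 ∈ Finset.Icc (1:ℤ) n := by rw [Finset.mem_Icc]; omega
  have h2 : (i+m+1)/2 ∈ Finset.Icc (1:ℤ) n := by rw [Finset.mem_Icc]; omega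
  have s1 : ∀ c ∈ Finset.Icc (1:ℤ) n,
      ∑ k ∈ Finset.Icc (1:ℤ) n, g k * (if k = c then (1:ℝ) else 0) = g c := by
    intro c hc
    simp only [mul_ite, mul_one, mul_zero, Finset.sum_ite_eq', if_pos hc]
  rw [← s1 _ h1, ← s1 _ h2, ← Finset.sum_add_distrib, Finset.sum_div, Finset.mul_sum]
  refine Finset.sum_congr rfl fun k _ => ?_
  ring

lemma sum_BDW (n : ℤ) (p : ℤ → ℝ) (ε i : ℤ) (hi : i ∈ Finset.Icc (1:ℤ) n) (f : ℤ → ℝ) :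
    ∑ k ∈ Finset.Icc (1:ℤ) n, f k * BDW n p ε i k =
      f i + ∑ k ∈ Finset.Icc (1:ℤ) n, (f k - f i) * BDWoff p ε i k := by
  rw [← Finset.add_sum_erase _ _ hi, ← Finset.add_sum_erase _ (fun k => (f k - f i) * _) hi]
  have h : ∑ k ∈ (Finset.Icc (1:ℤ) n).erase i, f k * BDW n p ε i k =
      ∑ k ∈ (Finset.Icc (1:ℤ) n).erase i, f k * BDWoff p ε i k := by
    refine Finset.sum_congr rfl fun k hk => ?_
    rw [BDW, if_neg (Finset.ne_of_mem_erase hk).symm]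
  rw [h, BDW, if_pos rfl]
  simp only [sub_mul, Finset.sum_sub_distrib, ← Finset.mul_sum]
  ring

/-- interaction weight -/
noncomputable def wDW (p : ℤ → ℝ) (ε i m : ℤ) : ℝ := p i * piF p ε i m

lemma wDW_comm (p : ℤ → ℝ) (ε i m : ℤ) : wDW p ε i m = wDW p ε m i := by
  unfold wDW piF
  rw [abs_sub_comm]
  split_ifs <;> ring

lemma sum_step (n : ℤ) (p : ℤ → ℝ) (ε : ℤ) (hp : IsDist n p) (f : ℤ → ℝ) :
    2 * (∑ k ∈ Finset.Icc (1:ℤ) n, f k * stepDW n p ε k - ∑ k ∈ Finset.Icc (1:ℤ) n, f k * p k) =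
      ∑ i ∈ Finset.Icc (1:ℤ) n, ∑ m ∈ Finset.Icc (1:ℤ) n, wDW p ε i m *
        (f ((i+m)/2) + f ((i+m+1)/2) - f i - f m) := by
  have h : ∑ k ∈ Finset.Icc (1:ℤ) n, f k * stepDW n p ε k - ∑ k ∈ Finset.Icc (1:ℤ) n, f k * p k =
      ∑ i ∈ Finset.Icc (1:ℤ) n, ∑ m ∈ Finset.Icc (1:ℤ) n, wDW p ε i m *
        ((f ((i+m)/2) + f ((i+m+1)/2)) / 2 - f i) := by
    simp_rw [stepDW, Finset.mul_sum]
    rw [Finset.sum_comm, ← Finset.sum_sub_distrib]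
    refine Finset.sum_congr rfl fun i hi => ?_
    have := sum_BDW n p ε i hi f
    rw [sum_BDWoff n p ε i hp hi] at this
    have e : ∑ k ∈ Finset.Icc (1:ℤ) n, f k * (p i * BDW n p ε i k) =
        p i * ∑ k ∈ Finset.Icc (1:ℤ) n, f k * BDW n p ε i k := by
      rw [Finset.mul_sum]
      exact Finset.sum_congr rfl fun k _ => by ring
    rw [e, this, mul_add, mul_comm (f i), add_sub_cancel_left, Finset.mul_sum]
    refine Finset.sum_congr rfl fun m _ => ?_
    unfold wDW
    ring
  have h' := h
  rw [Finset.sum_comm] at h'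
  rw [two_mul]
  nth_rewrite 2 [h']
  rw [h, ← Finset.sum_add_distrib]
  refine Finset.sum_congr rfl fun i _ => ?_
  rw [← Finset.sum_add_distrib]
  refine Finset.sum_congr rfl fun m _ => ?_
  rw [wDW_comm p ε m i, add_comm m i]
  ring

lemma near_zero (f : ℤ → ℝ) (i m : ℤ) (h : |i - m| ≤ 1) :
    f ((i+m)/2) + f ((i+m+1)/2) - f i - f m = 0 := by
  rw [abs_le] at h
  rcases le_total i m with h' | h'
  · rw [show (i+m)/2 = i by omega, show (i+m+1)/2 = m by omega]; ring
  · rw [show (i+m)/2 = m by omega, show (i+m+1)/2 = i by omega]; ring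

lemma far_neg_aux (i m : ℤ) (h : i + 2 ≤ m) :
    (2:ℝ)^((i+m)/2) + (2:ℝ)^((i+m+1)/2) - (2:ℝ)^i - (2:ℝ)^m < 0 := by
  have hi : (0:ℝ) < (2:ℝ)^i := by positivity
  have hmono : ∀ a b : ℤ, a ≤ b → (2:ℝ)^a ≤ (2:ℝ)^b := fun a b hab =>
    zpow_le_zpow_right₀ (by norm_num) hab
  have hs : ∀ a : ℤ, (2:ℝ)^(a+1) = 2 * (2:ℝ)^a := fun a => by
    rw [zpow_add_one₀ (by norm_num)]; ring
  have h1 := hmono ((i+m)/2) (m-1) (by omega)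
  have h2 := hmono ((i+m+1)/2) (m-1) (by omega)
  have h3 := hs (m-1)
  rw [sub_add_cancel] at h3
  linarith

lemma far_neg (i m : ℤ) (h : ¬ |i - m| ≤ 1) :
    (2:ℝ)^((i+m)/2) + (2:ℝ)^((i+m+1)/2) - (2:ℝ)^i - (2:ℝ)^m < 0 := by
  rw [abs_le] at h
  rcases le_total i m with h' | h'
  · exact far_neg_aux i m (by omega)
  · have := far_neg_aux m i (by omega)
    rw [add_comm m i] at this
    linarith

/-- `L` is a strict Lyapunov function for the DW interactive Markov
chain: it strictly decreases at every non-fixed point. -/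
theorem dw_chain_lyapunov_strict (n ε : ℤ) (hn : 1 ≤ n) (hε : 1 ≤ ε)
    (p : ℤ → ℝ) (hp : IsDist n p)
    (hnotfix : ¬ (∀ k ∈ Finset.Icc (1:ℤ) n, stepDW n p ε k = p k)) :
    Lyap n (stepDW n p ε) < Lyap n p := by
  by_contra hlt
  apply hnotfix
  have hw : ∀ i m, 0 ≤ wDW p ε i m := by
    intro i m
    unfold wDW piF
    refine mul_nonneg (hp.1 i) ?_
    split_ifs
    · exact hp.1 m
    · exact le_rfl
  have key := sum_step n p ε hp (fun k => (2:ℝ)^k)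
  have hterm : ∀ i m, wDW p ε i m *
      ((2:ℝ)^((i+m)/2) + (2:ℝ)^((i+m+1)/2) - (2:ℝ)^i - (2:ℝ)^m) ≤ 0 := by
    intro i m
    refine mul_nonpos_of_nonneg_of_nonpos (hw i m) ?_
    by_cases h : |i - m| ≤ 1
    · exact (near_zero (fun k => (2:ℝ)^k) i m h).le
    · exact (far_neg i m h).le
  have hin : ∀ i ∈ Finset.Icc (1:ℤ) n, ∑ m ∈ Finset.Icc (1:ℤ) n, wDW p ε i m *
      ((2:ℝ)^((i+m)/2) + (2:ℝ)^((i+m+1)/2) - (2:ℝ)^i - (2:ℝ)^m) ≤ 0 :=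
    fun i _ => Finset.sum_nonpos fun m _ => hterm i m
  have htot := Finset.sum_nonpos hin
  have hz : ∑ i ∈ Finset.Icc (1:ℤ) n, ∑ m ∈ Finset.Icc (1:ℤ) n, wDW p ε i m *
      ((2:ℝ)^((i+m)/2) + (2:ℝ)^((i+m+1)/2) - (2:ℝ)^i - (2:ℝ)^m) = 0 := by
    refine le_antisymm htot ?_
    rw [← key]
    unfold Lyap at hlt
    linarith
  rw [Finset.sum_eq_zero_iff_of_nonpos hin] at hz
  intro k hk
  have key2 := sum_step n p ε hp (fun j => if j = k then (1:ℝ) else 0)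
  rw [Finset.sum_eq_zero (fun i hi => Finset.sum_eq_zero fun m hm => ?_)] at key2
  · simp only [ite_mul, one_mul, zero_mul, Finset.sum_ite_eq', if_pos hk] at key2
    linarith
  · by_cases h : |i - m| ≤ 1
    · rw [near_zero (fun j => if j = k then (1:ℝ) else 0) i m h, mul_zero]
    · have h0 := (Finset.sum_eq_zero_iff_of_nonpos (fun m _ => hterm i m)).1 (hz i hi) m hm
      rcases mul_eq_zero.1 h0 with h1 | h1
      · rw [h1, zero_mul]
      · exact absurd h1 (far_neg i m h).ne
end

section
/- The DW interactive Markov chain has no nontrivial periodic orbit: if (p(t))_{t∈ℕ} is a trajectory of the DW chain, i.e. every p(t) is an opinion distribution and p(t+1) = p(t)B^DW(p(t),ε) for all t, and if p(t₀ + T) = p(t₀) for some t₀ ∈ ℕ and some period T ≥ 1, then p(t₀) is a fixed point of the DW chain. -/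
open Finset
open scoped Classical

/-- Averaged increment of `f` for an interacting pair. -/
noncomputable def incr (f : ℤ → ℝ) (i m : ℤ) : ℝ :=
  (f ((i+m)/2) + f ((i+m+1)/2)) / 2 - (f i + f m) / 2

lemma off_eq (n : ℤ) (p : ℤ → ℝ) (h0 : ∀ m, m ∉ Finset.Icc (1:ℤ) n → p m = 0) (ε i j : ℤ) :
    BDWoff p ε i j = ∑ m ∈ Finset.Icc (1:ℤ) n, piF p ε i m *
      (((if j = (i+m)/2 then 1 else 0) + (if j = (i+m+1)/2 then 1 else 0)) / 2) := by
  have key : ∀ a : ℤ, piF p ε i a = ∑ m ∈ Finset.Icc (1:ℤ) n, if m = a then piF p ε i m else 0 := by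
    intro a
    rw [Finset.sum_ite_eq' (Finset.Icc (1:ℤ) n) a]
    split_ifs with h
    · rfl
    · unfold piF
      rw [h0 a h]; simp
  unfold BDWoff
  rw [key (2*j-i-1), key (2*j-i), key (2*j-i+1), Finset.sum_div, Finset.sum_div,
    ← Finset.sum_add_distrib, ← Finset.sum_add_distrib]
  refine Finset.sum_congr rfl fun m _ => ?_
  by_cases h1 : m = 2*j-i-1
  · rw [if_pos h1, if_neg (by omega), if_neg (by omega), if_neg (by omega), if_pos (by omega)]; ring
  by_cases h2 : m = 2*j-i
  · rw [if_neg h1, if_pos h2, if_neg (by omega), if_pos (by omega), if_pos (by omega)]; ring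
  by_cases h3 : m = 2*j-i+1
  · rw [if_neg h1, if_neg h2, if_pos h3, if_pos (by omega), if_neg (by omega)]; ring
  · rw [if_neg h1, if_neg h2, if_neg h3, if_neg (by omega), if_neg (by omega)]; ring

lemma off_sum (n : ℤ) (p : ℤ → ℝ) (h0 : ∀ m, m ∉ Finset.Icc (1:ℤ) n → p m = 0) (ε i : ℤ)
    (hi : i ∈ Finset.Icc (1:ℤ) n) (g : ℤ → ℝ) :
    ∑ j ∈ Finset.Icc (1:ℤ) n, g j * BDWoff p ε i j =
      ∑ m ∈ Finset.Icc (1:ℤ) n, piF p ε i m * ((g ((i+m)/2) + g ((i+m+1)/2)) / 2) := by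
  simp_rw [off_eq n p h0 ε i, Finset.mul_sum]
  rw [Finset.sum_comm]
  refine Finset.sum_congr rfl fun m hm => ?_
  rw [Finset.mem_Icc] at hi hm
  have e : ∀ a : ℤ, a ∈ Finset.Icc (1:ℤ) n →
      ∑ j ∈ Finset.Icc (1:ℤ) n, g j * (if j = a then (1:ℝ) else 0) = g a := by
    intro a ha
    simp only [mul_ite, mul_one, mul_zero]
    rw [Finset.sum_ite_eq' (Finset.Icc (1:ℤ) n) a, if_pos ha]
  rw [← e ((i+m)/2) (by rw [Finset.mem_Icc]; omega),
    ← e ((i+m+1)/2) (by rw [Finset.mem_Icc]; omega), ← Finset.sum_add_distrib,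
    Finset.sum_div, Finset.mul_sum]
  refine Finset.sum_congr rfl fun j _ => ?_
  ring

lemma row_sum (n : ℤ) (p : ℤ → ℝ) (ε i : ℤ)
    (hi : i ∈ Finset.Icc (1:ℤ) n) (f : ℤ → ℝ) :
    ∑ j ∈ Finset.Icc (1:ℤ) n, f j * BDW n p ε i j =
      f i + ∑ j ∈ Finset.Icc (1:ℤ) n, (f j - f i) * BDWoff p ε i j := by
  rw [← Finset.add_sum_erase _ _ hi, ← Finset.add_sum_erase _ (fun j => (f j - f i) * _) hi]
  have : ∑ x ∈ (Finset.Icc (1:ℤ) n).erase i, f x * BDW n p ε i x =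
      ∑ x ∈ (Finset.Icc (1:ℤ) n).erase i, f x * BDWoff p ε i x := by
    refine Finset.sum_congr rfl fun j hj => ?_
    rw [BDW, if_neg (Finset.ne_of_mem_erase hj).symm]
  rw [this, BDW, if_pos rfl]
  simp only [sub_mul, Finset.sum_sub_distrib, ← Finset.mul_sum]
  ring

lemma piF_symm (p : ℤ → ℝ) (ε i m : ℤ) : p i * piF p ε i m = p m * piF p ε m i := by
  unfold piF
  rw [abs_sub_comm]
  split_ifs <;> ring

lemma master (n : ℤ) (p : ℤ → ℝ) (h0 : ∀ m, m ∉ Finset.Icc (1:ℤ) n → p m = 0) (ε : ℤ)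
    (f : ℤ → ℝ) :
    ∑ k ∈ Finset.Icc (1:ℤ) n, f k * stepDW n p ε k =
      ∑ k ∈ Finset.Icc (1:ℤ) n, f k * p k +
      ∑ i ∈ Finset.Icc (1:ℤ) n, ∑ m ∈ Finset.Icc (1:ℤ) n, p i * piF p ε i m * incr f i m := by
  have h1 : ∑ k ∈ Finset.Icc (1:ℤ) n, f k * stepDW n p ε k =
      ∑ i ∈ Finset.Icc (1:ℤ) n, (f i * p i + ∑ m ∈ Finset.Icc (1:ℤ) n, p i * piF p ε i m *
        ((f ((i+m)/2) + f ((i+m+1)/2)) / 2 - f i)) := by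
    simp_rw [stepDW, Finset.mul_sum]
    rw [Finset.sum_comm]
    refine Finset.sum_congr rfl fun i hi => ?_
    have := row_sum n p ε i hi f
    rw [off_sum n p h0 ε i hi (fun j => f j - f i)] at this
    calc _ = p i * ∑ j ∈ Finset.Icc (1:ℤ) n, f j * BDW n p ε i j := by
          rw [Finset.mul_sum]; exact Finset.sum_congr rfl fun j _ => by ring
      _ = _ := by
          rw [this, mul_add, Finset.mul_sum, mul_comm]
          congr 1
          exact Finset.sum_congr rfl fun j _ => by ring
  rw [h1, Finset.sum_add_distrib]
  congr 1
  have h2 : ∑ i ∈ Finset.Icc (1:ℤ) n, ∑ m ∈ Finset.Icc (1:ℤ) n, p i * piF p ε i m * f i =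
      ∑ i ∈ Finset.Icc (1:ℤ) n, ∑ m ∈ Finset.Icc (1:ℤ) n, p i * piF p ε i m * f m := by
    rw [Finset.sum_comm]
    refine Finset.sum_congr rfl fun i _ => Finset.sum_congr rfl fun m _ => ?_
    rw [piF_symm]
  have h3 : ∀ i m, p i * piF p ε i m * ((f ((i+m)/2) + f ((i+m+1)/2)) / 2 - f i) =
      p i * piF p ε i m * incr f i m +
        (p i * piF p ε i m * f m - p i * piF p ε i m * f i) / 2 := by
    intro i m; unfold incr; ring
  simp_rw [h3, Finset.sum_add_distrib, ← Finset.sum_div, Finset.sum_sub_distrib]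
  rw [h2]; ring

lemma incr_sq (i m : ℤ) : incr (fun k => (k:ℝ)^2) i m ≤ 0 ∧
    (incr (fun k => (k:ℝ)^2) i m = 0 → |i - m| ≤ 1) := by
  rcases Int.even_or_odd' (i+m) with ⟨s, h | h⟩
  · have ha : (i+m)/2 = s := by omega
    have hb : (i+m+1)/2 = s := by omega
    have hm : m = 2*s - i := by omega
    have e : incr (fun k => (k:ℝ)^2) i m = -((i - s : ℤ):ℝ)^2 := by
      simp only [incr, ha, hb]; subst hm; push_cast; ring
    rw [e]
    refine ⟨by nlinarith [sq_nonneg ((i - s : ℤ):ℝ)], fun h0 => ?_⟩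
    have h1 : ((i - s : ℤ):ℝ) = 0 := by
      have : ((i - s : ℤ):ℝ)^2 = 0 := by linarith
      exact pow_eq_zero_iff (two_ne_zero) |>.1 this
    have h2 : i - s = 0 := by exact_mod_cast h1
    rw [abs_le]; omega
  · have ha : (i+m)/2 = s := by omega
    have hb : (i+m+1)/2 = s+1 := by omega
    have hm : m = 2*s + 1 - i := by omega
    have e : incr (fun k => (k:ℝ)^2) i m = -(((i - s) * (i - s - 1) : ℤ):ℝ) := by
      simp only [incr, ha, hb]; subst hm; push_cast; ring
    rw [e]
    constructor
    · have : 0 ≤ (i - s) * (i - s - 1) := by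
        rcases le_or_gt (i - s) 0 with h | h
        · nlinarith
        · exact mul_nonneg (by omega) (by omega)
      have : (0:ℝ) ≤ (((i - s) * (i - s - 1) : ℤ):ℝ) := by exact_mod_cast this
      linarith
    · intro h0
      have h1 : (i - s) * (i - s - 1) = 0 := by
        have : (((i - s) * (i - s - 1) : ℤ):ℝ) = 0 := by linarith
        exact_mod_cast this
      rw [abs_le]
      rcases mul_eq_zero.1 h1 with h | h <;> omega

lemma incr_near (f : ℤ → ℝ) (i m : ℤ) (h : |i - m| ≤ 1) : incr f i m = 0 := by
  rw [abs_le] at h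
  have : m = i ∨ m = i + 1 ∨ m = i - 1 := by omega
  unfold incr
  rcases this with rfl | rfl | rfl
  · rw [show (m+m)/2 = m by omega, show (m+m+1)/2 = m by omega]; ring
  · rw [show (i+(i+1))/2 = i by omega, show (i+(i+1)+1)/2 = i+1 by omega]; ring
  · rw [show (i+(i-1))/2 = i-1 by omega, show (i+(i-1)+1)/2 = i by omega]; ring

/-- the DW interactive Markov chain has no nontrivial periodic orbit:
a trajectory returning to a previous state must already be at a fixed point. -/
theorem dw_chain_no_periodic_orbit (n ε : ℤ) (hn : 1 ≤ n) (hε : 1 ≤ ε)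
    (p : ℕ → ℤ → ℝ) (hdist : ∀ t, IsDist n (p t))
    (htraj : ∀ t, ∀ k ∈ Finset.Icc (1:ℤ) n, p (t+1) k = stepDW n (p t) ε k)
    (t₀ T : ℕ) (hT : 1 ≤ T) (hper : p (t₀ + T) = p t₀) :
    ∀ k ∈ Finset.Icc (1:ℤ) n, stepDW n (p t₀) ε k = p t₀ k := by
  have hq : ∀ t i m, 0 ≤ p t i * piF (p t) ε i m := by
    intro t i m
    refine mul_nonneg ((hdist t).1 i) ?_
    unfold piF
    split_ifs
    · exact (hdist t).1 m
    · exact le_rfl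
  have hterm : ∀ t i m, p t i * piF (p t) ε i m * incr (fun k => (k:ℝ)^2) i m ≤ 0 :=
    fun t i m => mul_nonpos_of_nonneg_of_nonpos (hq t i m) (incr_sq i m).1
  let V : ℕ → ℝ := fun t => ∑ k ∈ Finset.Icc (1:ℤ) n, (k:ℝ)^2 * p t k
  have hstep : ∀ t, V (t+1) = V t + ∑ i ∈ Finset.Icc (1:ℤ) n, ∑ m ∈ Finset.Icc (1:ℤ) n,
      p t i * piF (p t) ε i m * incr (fun k => (k:ℝ)^2) i m := by
    intro t
    have := master n (p t) (hdist t).2.1 ε (fun k => (k:ℝ)^2)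
    rw [← this]
    exact Finset.sum_congr rfl fun k hk => by rw [htraj t k hk]
  have hanti : Antitone V := by
    refine antitone_nat_of_succ_le fun t => ?_
    rw [hstep t]
    have := Finset.sum_nonpos (s := Finset.Icc (1:ℤ) n) fun i _ =>
      Finset.sum_nonpos (s := Finset.Icc (1:ℤ) n) fun m _ => hterm t i m
    linarith
  have hV : V (t₀ + T) = V t₀ := by simp only [V, hper]
  have h1 : V (t₀ + T) ≤ V (t₀ + 1) := hanti (by omega)
  have hz : ∑ i ∈ Finset.Icc (1:ℤ) n, ∑ m ∈ Finset.Icc (1:ℤ) n,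
      p t₀ i * piF (p t₀) ε i m * incr (fun k => (k:ℝ)^2) i m = 0 := by
    apply le_antisymm
    · exact Finset.sum_nonpos fun i _ => Finset.sum_nonpos fun m _ => hterm t₀ i m
    · have := hstep t₀
      linarith
  rw [Finset.sum_eq_zero_iff_of_nonpos
    (fun i _ => Finset.sum_nonpos fun m _ => hterm t₀ i m)] at hz
  intro k hk
  have hm := master n (p t₀) (hdist t₀).2.1 ε (fun j => if j = k then 1 else 0)
  have hz2 : ∑ i ∈ Finset.Icc (1:ℤ) n, ∑ m ∈ Finset.Icc (1:ℤ) n,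
      p t₀ i * piF (p t₀) ε i m * incr (fun j => if j = k then 1 else 0) i m = 0 := by
    refine Finset.sum_eq_zero fun i hi => Finset.sum_eq_zero fun m hm => ?_
    have h2 := hz i hi
    rw [Finset.sum_eq_zero_iff_of_nonpos (fun m _ => hterm t₀ i m)] at h2
    rcases mul_eq_zero.1 (h2 m hm) with h | h
    · rw [h, zero_mul]
    · rw [incr_near _ i m ((incr_sq i m).2 h), mul_zero]
  rw [hz2, add_zero] at hm
  simp only [ite_mul, one_mul, zero_mul] at hm
  rw [Finset.sum_ite_eq' (Finset.Icc (1:ℤ) n) k, Finset.sum_ite_eq' (Finset.Icc (1:ℤ) n) k,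
    if_pos hk, if_pos hk] at hm
  exact hm
end

section
/- Let p be a fixed point of the HK interactive Markov chain and let i ∈ {1,…,n} with p i > 0. For k ∈ {1,…,n} let S_k := {j ∈ {1,…,n} | p j > 0 and k−1 < M_j < k+1} (the set of classes whose population flows into class k). Then exactly one of the following holds: (i) M_i = i and S_i = {i}; (ii) i < M_i ≤ M_{i+1} < i+1, p (i+1) > 0, and S_i = {i, i+1} = S_{i+1}; (iii) i−1 < M_{i−1} ≤ M_i < i, p (i−1) > 0, and S_i = {i−1, i} = S_{i−1}. -/
open Finset
open scoped Classical

/-- The barycenter `M^bary_{[a..b]}(p)`: the mean class of `p` on `[a..b]`,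
and the midpoint `(a+b)/2` if `p` has no mass there. -/
noncomputable def Mbary (p : ℤ → ℝ) (a b : ℤ) : ℝ :=
  if (∑ k ∈ Finset.Icc a b, p k) ≠ 0 then
    (∑ k ∈ Finset.Icc a b, (k:ℝ) * p k) / (∑ k ∈ Finset.Icc a b, p k)
  else ((a:ℝ) + (b:ℝ)) / 2

/-- The `ε`-local mean `M_i = M^bary_{[i-ε..i+ε]}(p)`. -/
noncomputable def locM (p : ℤ → ℝ) (ε i : ℤ) : ℝ := Mbary p (i - ε) (i + ε)

/-- The Hegselmann–Krause transition matrix `B^HK(p,ε)` on `{1,…,n} × {1,…,n}`. -/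
noncomputable def BHK (p : ℤ → ℝ) (ε i j : ℤ) : ℝ :=
  if (j:ℝ) = locM p ε i then 1
  else if j = ⌊locM p ε i⌋ then (⌈locM p ε i⌉ : ℝ) - locM p ε i
  else if j = ⌈locM p ε i⌉ then locM p ε i - (⌊locM p ε i⌋ : ℝ)
  else 0

/-- One step of the HK interactive Markov chain: `(pB^HK(p,ε)) k`. -/
noncomputable def stepHK (n : ℤ) (p : ℤ → ℝ) (ε : ℤ) (k : ℤ) : ℝ :=
  ∑ i ∈ Finset.Icc (1:ℤ) n, p i * BHK p ε i k

theorem BHK_tent (p : ℤ → ℝ) (ε i j : ℤ) :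
    BHK p ε i j = max 0 (1 - |locM p ε i - j|) := by
  unfold BHK
  generalize locM p ε i = M
  have h1 := Int.floor_le M
  have h2 := Int.lt_floor_add_one M
  split_ifs with ha hb hc
  · rw [← ha]; simp
  · have hne : ((⌊M⌋ : ℤ) : ℝ) ≠ M := by rw [← hb]; exact ha
    have hlt : ((⌊M⌋ : ℤ) : ℝ) < M := lt_of_le_of_ne h1 hne
    have hc : ⌈M⌉ = ⌊M⌋ + 1 := by
      rw [Int.ceil_eq_iff]; push_cast; constructor <;> linarith
    rw [hc, hb, abs_of_pos (by linarith), max_eq_right (by linarith)]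
    push_cast; ring
  · have hlt : ((⌊M⌋ : ℤ) : ℝ) < M := by
      refine lt_of_le_of_ne h1 fun h => ha ?_
      rw [hc, ← h]; simp
    have hc' : ⌈M⌉ = ⌊M⌋ + 1 := by
      rw [Int.ceil_eq_iff]; push_cast; constructor <;> linarith
    rw [hc, hc']; push_cast
    rw [abs_of_neg (by linarith), max_eq_right (by linarith)]
    ring
  · symm
    apply max_eq_left
    by_contra hcon
    push Not at hcon
    have h3 : |M - j| < 1 := by linarith
    rw [abs_lt] at h3
    rcases lt_or_ge M j with h | h
    · apply hc; symm
      rw [Int.ceil_eq_iff]; constructor <;> linarith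
    · apply hb; symm
      rw [Int.floor_eq_iff]; constructor <;> linarith

theorem BHK_nonneg' (p : ℤ → ℝ) (ε i j : ℤ) : 0 ≤ BHK p ε i j := by
  rw [BHK_tent]; exact le_max_left _ _

theorem BHK_pos_iff (p : ℤ → ℝ) (ε i j : ℤ) :
    0 < BHK p ε i j ↔ (j : ℝ) - 1 < locM p ε i ∧ locM p ε i < j + 1 := by
  rw [BHK_tent, lt_max_iff]
  simp only [lt_irrefl, false_or, sub_pos, abs_lt]
  constructor <;> rintro ⟨h1, h2⟩ <;> constructor <;> linarith

theorem BHK_sum_le (p : ℤ → ℝ) (ε i : ℤ) (A : Finset ℤ) : ∑ j ∈ A, BHK p ε i j ≤ 1 := by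
  have h1 := Int.floor_le (locM p ε i)
  have h2 := Int.lt_floor_add_one (locM p ε i)
  calc ∑ j ∈ A, BHK p ε i j
      ≤ ∑ j ∈ A ∪ {⌊locM p ε i⌋, ⌊locM p ε i⌋ + 1}, BHK p ε i j :=
        Finset.sum_le_sum_of_subset_of_nonneg Finset.subset_union_left
          fun _ _ _ => BHK_nonneg' _ _ _ _
    _ = ∑ j ∈ {⌊locM p ε i⌋, ⌊locM p ε i⌋ + 1}, BHK p ε i j := by
        symm
        apply Finset.sum_subset Finset.subset_union_right
        intro x _ hx
        by_contra hne
        have hpos := lt_of_le_of_ne (BHK_nonneg' p ε i x) (Ne.symm hne)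
        rw [BHK_pos_iff] at hpos
        have a1 : x < ⌊locM p ε i⌋ + 2 := by
          have : (x : ℝ) < ((⌊locM p ε i⌋ + 2 : ℤ) : ℝ) := by push_cast; linarith
          exact_mod_cast this
        have a2 : ⌊locM p ε i⌋ < x + 1 := by
          have : ((⌊locM p ε i⌋ : ℤ) : ℝ) < ((x + 1 : ℤ) : ℝ) := by push_cast; linarith
          exact_mod_cast this
        simp only [Finset.mem_insert, Finset.mem_singleton, not_or] at hx
        omega
    _ = 1 := by
        rw [Finset.sum_pair (by omega), BHK_tent, BHK_tent]
        push_cast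
        rw [abs_of_nonneg (by linarith), abs_of_neg (by linarith), max_eq_right (by linarith),
          max_eq_right (by linarith)]
        ring
    _ ≤ 1 := le_rfl

theorem HK_escape (n ε : ℤ) (p : ℤ → ℝ) (hp : IsDist n p)
    (hfix : ∀ k ∈ Finset.Icc (1:ℤ) n, stepHK n p ε k = p k)
    (A : Finset ℤ) (hA : A ⊆ Finset.Icc (1:ℤ) n) (j m : ℤ) (hj : j ∈ A) (hpj : 0 < p j)
    (hm : m ∉ A) (hB : 0 < BHK p ε j m) :
    ∃ j' ∈ Finset.Icc (1:ℤ) n, j' ∉ A ∧ 0 < p j' ∧ ∃ m' ∈ A, 0 < BHK p ε j' m' := by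
  by_contra hcon
  push Not at hcon
  have e1 : ∑ k ∈ A, p k = ∑ i ∈ Finset.Icc (1:ℤ) n, p i * ∑ k ∈ A, BHK p ε i k := by
    simp_rw [Finset.mul_sum]
    rw [Finset.sum_comm]
    exact Finset.sum_congr rfl fun k hk => (hfix k (hA hk)).symm
  have e2 : ∑ i ∈ Finset.Icc (1:ℤ) n, p i * ∑ k ∈ A, BHK p ε i k
      = ∑ i ∈ A, p i * ∑ k ∈ A, BHK p ε i k := by
    symm
    apply Finset.sum_subset hA
    intro x hx hxA
    rcases (hp.1 x).lt_or_eq with h | h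
    · rw [Finset.sum_eq_zero, mul_zero]
      intro k hk
      exact le_antisymm (hcon x hx hxA h k hk) (BHK_nonneg' _ _ _ _)
    · rw [← h, zero_mul]
  have hlt : ∑ k ∈ A, BHK p ε j k < 1 := by
    have := BHK_sum_le p ε j (insert m A)
    rw [Finset.sum_insert hm] at this
    linarith
  have e3 : ∑ i ∈ A, p i * ∑ k ∈ A, BHK p ε i k < ∑ i ∈ A, p i := by
    apply Finset.sum_lt_sum
    · intro i _
      exact mul_le_of_le_one_right (hp.1 i) (BHK_sum_le _ _ _ _)
    · exact ⟨j, hj, mul_lt_of_lt_one_right hpj hlt⟩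
  linarith

theorem HK_right (n ε : ℤ) (p : ℤ → ℝ) (hp : IsDist n p)
    (hfix : ∀ k ∈ Finset.Icc (1:ℤ) n, stepHK n p ε k = p k) (j k : ℤ) (hpj : 0 < p j)
    (hjk : j ≤ k) (hM : (k:ℝ) < locM p ε j) :
    ∃ j', k < j' ∧ 0 < p j' ∧ locM p ε j' < k + 1 := by
  have hj : j ∈ Finset.Icc (1:ℤ) n := by
    by_contra h
    exact hpj.ne' (hp.2.1 j h)
  rw [Finset.mem_Icc] at hj
  obtain ⟨j', h1, h2, h3, m, h4, h5⟩ := HK_escape n ε p hp hfix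
    ((Finset.Icc 1 n).filter (· ≤ k)) (Finset.filter_subset _ _) j ⌈locM p ε j⌉
    (by simp; omega) hpj (by
      simp only [Finset.mem_filter, not_and, not_le]
      intro _
      exact Int.lt_ceil.2 hM)
    (by
      rw [BHK_pos_iff]
      have a := Int.le_ceil (locM p ε j)
      have b := Int.ceil_lt_add_one (locM p ε j)
      constructor <;> linarith)
  rw [BHK_pos_iff] at h5
  simp only [Finset.mem_filter] at h2 h4
  refine ⟨j', ?_, h3, ?_⟩
  · by_contra h; exact h2 ⟨h1, by omega⟩
  · have : (m:ℝ) ≤ k := by exact_mod_cast h4.2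
    linarith

theorem HK_left (n ε : ℤ) (p : ℤ → ℝ) (hp : IsDist n p)
    (hfix : ∀ k ∈ Finset.Icc (1:ℤ) n, stepHK n p ε k = p k) (j k : ℤ) (hpj : 0 < p j)
    (hjk : k < j) (hM : locM p ε j < k + 1) :
    ∃ j', j' ≤ k ∧ 0 < p j' ∧ (k:ℝ) < locM p ε j' := by
  have hj : j ∈ Finset.Icc (1:ℤ) n := by
    by_contra h
    exact hpj.ne' (hp.2.1 j h)
  rw [Finset.mem_Icc] at hj
  obtain ⟨j', h1, h2, h3, m, h4, h5⟩ := HK_escape n ε p hp hfix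
    ((Finset.Icc 1 n).filter (k < ·)) (Finset.filter_subset _ _) j ⌊locM p ε j⌋
    (by simp; omega) hpj (by
      simp only [Finset.mem_filter, not_and, not_lt]
      intro _
      have : ⌊locM p ε j⌋ < k + 1 := Int.floor_lt.2 (by push_cast; exact hM)
      omega)
    (by
      rw [BHK_pos_iff]
      have a := Int.floor_le (locM p ε j)
      have b := Int.lt_floor_add_one (locM p ε j)
      constructor <;> linarith)
  rw [BHK_pos_iff] at h5
  simp only [Finset.mem_filter] at h2 h4
  refine ⟨j', ?_, h3, ?_⟩
  · by_contra h; exact h2 ⟨h1, by omega⟩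
  · have : (k:ℝ) + 1 ≤ m := by exact_mod_cast h4.2
    linarith

theorem locM_mono (p : ℤ → ℝ) (hp : ∀ m, 0 ≤ p m) (ε : ℤ) (hε : 1 ≤ ε) (i j : ℤ)
    (hpi : 0 < p i) (hpj : 0 < p j) (hij : i ≤ j) : locM p ε i ≤ locM p ε j := by
  have mass : ∀ i, 0 < p i → 0 < ∑ k ∈ Finset.Icc (i - ε) (i + ε), p k := fun i h =>
    lt_of_lt_of_le h (Finset.single_le_sum (f := p) (fun k _ => hp k)
      (Finset.mem_Icc.2 ⟨by omega, by omega⟩))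
  have eqn : ∀ i, 0 < p i →
      ∑ k ∈ Finset.Icc (i - ε) (i + ε), (k:ℝ) * p k
        = locM p ε i * ∑ k ∈ Finset.Icc (i - ε) (i + ε), p k := by
    intro i h
    have := (mass i h).ne'
    unfold locM Mbary
    rw [if_pos this, div_mul_cancel₀ _ this]
  have hi := eqn i hpi
  have hj := eqn j hpj
  have mi := mass i hpi
  have mj := mass j hpj
  generalize locM p ε i = M at *
  generalize locM p ε j = N at *
  have split : ∀ s : Finset ℤ, ∑ k ∈ s, ((k:ℝ) - M) * p k
      = ∑ k ∈ s, (k:ℝ) * p k - M * ∑ k ∈ s, p k := by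
    intro s
    rw [Finset.mul_sum, ← Finset.sum_sub_distrib]
    exact Finset.sum_congr rfl fun _ _ => by ring
  have hMb : M ≤ ((i + ε : ℤ) : ℝ) := by
    by_contra h
    push Not at h
    have : ∑ k ∈ Finset.Icc (i - ε) (i + ε), (k:ℝ) * p k
        ≤ ((i + ε : ℤ) : ℝ) * ∑ k ∈ Finset.Icc (i - ε) (i + ε), p k := by
      rw [Finset.mul_sum]
      apply Finset.sum_le_sum
      intro k hk
      rw [Finset.mem_Icc] at hk
      exact mul_le_mul_of_nonneg_right (by exact_mod_cast hk.2) (hp k)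
    nlinarith
  have key : 0 ≤ ∑ k ∈ Finset.Icc (j - ε) (j + ε), ((k:ℝ) - M) * p k := by
    rcases le_or_gt M ((j - ε : ℤ) : ℝ) with h | h
    · apply Finset.sum_nonneg
      intro k hk
      rw [Finset.mem_Icc] at hk
      have : ((j - ε : ℤ) : ℝ) ≤ k := by exact_mod_cast hk.1
      exact mul_nonneg (by linarith) (hp k)
    · have z : ∑ k ∈ Finset.Icc (i - ε) (i + ε), ((k:ℝ) - M) * p k = 0 := by
        rw [split]; linarith
      have d := Finset.sum_sdiff_sub_sum_sdiff (s₁ := Finset.Icc (i - ε) (i + ε))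
        (s₂ := Finset.Icc (j - ε) (j + ε)) (f := fun k : ℤ => ((k:ℝ) - M) * p k)
      have d1 : 0 ≤ ∑ k ∈ Finset.Icc (j - ε) (j + ε) \ Finset.Icc (i - ε) (i + ε),
          ((k:ℝ) - M) * p k := by
        apply Finset.sum_nonneg
        intro k hk
        simp only [Finset.mem_sdiff, Finset.mem_Icc] at hk
        have : ((i + ε : ℤ) : ℝ) ≤ k := by
          have : i + ε ≤ k := by omega
          exact_mod_cast this
        exact mul_nonneg (by linarith) (hp k)
      have d2 : ∑ k ∈ Finset.Icc (i - ε) (i + ε) \ Finset.Icc (j - ε) (j + ε),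
          ((k:ℝ) - M) * p k ≤ 0 := by
        apply Finset.sum_nonpos
        intro k hk
        simp only [Finset.mem_sdiff, Finset.mem_Icc] at hk
        have : (k:ℝ) ≤ ((j - ε : ℤ) : ℝ) := by
          have : k ≤ j - ε := by omega
          exact_mod_cast this
        exact mul_nonpos_of_nonpos_of_nonneg (by linarith) (hp k)
      linarith
  rw [split, hj] at key
  nlinarith

/-- in a fixed point of the HK interactive Markov chain, for each class
`i` with positive mass, with `S k = {j ∈ {1,…,n} | p j > 0 ∧ k-1 < M_j < k+1}` the set
of classes flowing into `k`, exactly one of three configurations occurs (the three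
cases are mutually exclusive since they require `M_i = i`, `M_i > i`, `M_i < i`
respectively). -/
theorem hk_chain_fixed_trichotomy (n ε : ℤ) (hn : 1 ≤ n) (hε : 1 ≤ ε)
    (p : ℤ → ℝ) (hp : IsDist n p)
    (hfix : ∀ k ∈ Finset.Icc (1:ℤ) n, stepHK n p ε k = p k)
    (i : ℤ) (hi : i ∈ Finset.Icc (1:ℤ) n) (hpi : 0 < p i)
    (S : ℤ → Finset ℤ)
    (hS : ∀ k, S k = (Finset.Icc (1:ℤ) n).filter
      (fun j => 0 < p j ∧ (k:ℝ) - 1 < locM p ε j ∧ locM p ε j < (k:ℝ) + 1)) :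
    (locM p ε i = (i:ℝ) ∧ S i = {i}) ∨
    ((i:ℝ) < locM p ε i ∧ locM p ε i ≤ locM p ε (i+1) ∧ locM p ε (i+1) < (i:ℝ) + 1 ∧
      0 < p (i+1) ∧ S i = {i, i+1} ∧ S (i+1) = S i) ∨
    ((i:ℝ) - 1 < locM p ε (i-1) ∧ locM p ε (i-1) ≤ locM p ε i ∧ locM p ε i < (i:ℝ) ∧
      0 < p (i-1) ∧ S i = {i-1, i} ∧ S (i-1) = S i) := by
  have mono := fun a b ha hb hab => locM_mono p hp.1 ε hε a b ha hb hab
  have hR := fun j k => HK_right n ε p hp hfix j k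
  have hL := fun j k => HK_left n ε p hp hfix j k
  have supp : ∀ j, 0 < p j → j ∈ Finset.Icc (1:ℤ) n := by
    intro j hj
    by_contra h
    exact hj.ne' (hp.2.1 j h)
  -- no right crossing of the cut `a-1 | a` when `M_a ≥ a`
  have noR : ∀ a j, 0 < p a → (a:ℝ) ≤ locM p ε a → 0 < p j → j < a →
      locM p ε j ≤ (a:ℝ) - 1 := by
    intro a j ha hMa hj hja
    by_contra h
    push Not at h
    obtain ⟨j', h1, h2, h3⟩ := hR j (a - 1) hj (by omega) (by push_cast; exact h)
    have := mono a j' ha h2 (by omega)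
    push_cast at h3
    linarith
  -- no left crossing of the cut `a | a+1` when `M_a ≤ a`
  have noL : ∀ a j, 0 < p a → locM p ε a ≤ (a:ℝ) → 0 < p j → a < j →
      (a:ℝ) + 1 ≤ locM p ε j := by
    intro a j ha hMa hj hja
    by_contra h
    push Not at h
    obtain ⟨j', h1, h2, h3⟩ := hL j a hj hja h
    have := mono j' a h2 ha h1
    linarith
  -- a pair `a, a+1` with both means strictly between
  have pair : ∀ a, 0 < p a → 0 < p (a+1) → (a:ℝ) < locM p ε a →
      locM p ε (a+1) < (a:ℝ) + 1 → S a = {a, a+1} ∧ S (a+1) = {a, a+1} := by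
    intro a ha hb h1 h2
    have h3 := mono a (a+1) ha hb (by omega)
    have lo := fun j => noR a j ha h1.le
    have hi' := fun j => noL (a+1) j hb (by push_cast; exact h2.le)
    push_cast at hi'
    constructor
    · rw [hS]
      ext j
      simp only [Finset.mem_filter, Finset.mem_insert, Finset.mem_singleton]
      constructor
      · rintro ⟨_, q1, q2, q3⟩
        by_contra hne
        rcases lt_or_ge j a with h | h
        · have := lo j q1 h; linarith
        · have := hi' j q1 (by omega); linarith
      · rintro (rfl | rfl)
        · exact ⟨supp _ ha, ha, by linarith, by linarith⟩
        · exact ⟨supp _ hb, hb, by linarith, by linarith⟩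
    · rw [hS]
      ext j
      simp only [Finset.mem_filter, Finset.mem_insert, Finset.mem_singleton]
      push_cast
      constructor
      · rintro ⟨_, q1, q2, q3⟩
        by_contra hne
        rcases lt_or_ge j a with h | h
        · have := lo j q1 h; linarith
        · have := hi' j q1 (by omega); linarith
      · rintro (rfl | rfl)
        · exact ⟨supp _ ha, ha, by linarith, by linarith⟩
        · exact ⟨supp _ hb, hb, by linarith, by linarith⟩
  rcases lt_trichotomy (locM p ε i) (i:ℝ) with h | h | h
  · right; right
    obtain ⟨j', h1, h2, h3⟩ := hL i (i-1) hpi (by omega) (by push_cast; linarith)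
    push_cast at h3
    have hj : j' = i - 1 := by
      by_contra hne
      obtain ⟨l, l1, l2, l3⟩ := hR j' (i-2) h2 (by omega) (by push_cast; linarith)
      push_cast at l3
      have := mono j' l h2 l2 (by omega)
      linarith
    subst hj
    have e : i - 1 + 1 = i := by omega
    have pr := pair (i-1) h2 (by rw [e]; exact hpi) (by push_cast; exact h3)
      (by rw [e]; push_cast; linarith)
    rw [e] at pr
    exact ⟨h3, mono _ _ h2 hpi (by omega), h, h2, pr.2, pr.1.trans pr.2.symm⟩
  · left
    refine ⟨h, ?_⟩
    rw [hS]
    ext j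
    simp only [Finset.mem_filter, Finset.mem_singleton]
    constructor
    · rintro ⟨_, q1, q2, q3⟩
      rcases lt_trichotomy j i with hj | hj | hj
      · have := noR i j hpi h.ge q1 hj; linarith
      · exact hj
      · have := noL i j hpi h.le q1 hj; linarith
    · rintro rfl
      exact ⟨hi, hpi, by linarith, by linarith⟩
  · right; left
    obtain ⟨j', h1, h2, h3⟩ := hR i i hpi le_rfl h
    have hj : j' = i + 1 := by
      by_contra hne
      obtain ⟨l, l1, l2, l3⟩ := hL j' (i+1) h2 (by omega) (by push_cast; linarith)
      push_cast at l3
      have := mono l j' l2 h2 (by omega)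
      linarith
    subst hj
    have pr := pair i hpi h2 h h3
    exact ⟨h, mono _ _ hpi h2 (by omega), h3, h2, pr.1, pr.2.trans pr.1.symm⟩
end
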